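/- There exists a constant κ > 0 such that for every constant c ≥ 1 and all sufficiently large n the following holds in a KSWN* on n nodes: let x, t be nodes with Dist(x,t) ≥ c · (log₂ n)² · log₂ log₂ n, let r be the midpoint of the segment from x to t, and let r' be the node between r and t with Dist(r,r') = ⌈(log₂ n)² · log₂ log₂ n⌉. Then the probability that some node of the AL-awareness A_x(⌈log₂ log₂ n⌉) has its K-neighbor in the segment of nodes between r and r' is at most κ/c. -/

import Mathlib

open scoped Classical BigOperators ENNReal

noncomputable section

/-- Ring (Manhattan) distance on the cycle `ZMod n`:
`Dist(u,v) = min((v-u) mod n, (u-v) mod n)`. -/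
def ringDist (n : ℕ) (u v : ZMod n) : ℕ := min (v - u).val (u - v).val

/-- The harmonic normalization constant `Z_u = Σ_{z ≠ u} 1 / Dist(u,z)`. -/
def Zconst (n : ℕ) (u : ZMod n) : ℝ :=
  ∑' z : ZMod n, if z = u then 0 else ((ringDist n u z : ℝ))⁻¹

/-- Probability that the K-link of `u` points to `v`:
`Pr[u → v] = 1 / (Z_u · Dist(u,v))` for `v ≠ u`. -/
def kProb (n : ℕ) (u v : ZMod n) : ℝ :=
  if v = u then 0 else (Zconst n u * (ringDist n u v : ℝ))⁻¹

/-- The number `⌈(log₂ n)²⌉` of candidate AL-neighbours of a node. -/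
def alCount (n : ℕ) : ℕ := ⌈(Real.logb 2 n) ^ 2⌉₊

/-- Probability that a single AL-link of `u` points to `v`: the link is chosen
uniformly among the nodes `u+1, …, u+⌈(log₂ n)²⌉` (mod n). -/
def alProb (n : ℕ) (u v : ZMod n) : ℝ :=
  if ∃ i ∈ Finset.Icc 1 (alCount n), u + (i : ZMod n) = v then ((alCount n : ℝ))⁻¹ else 0

/-- A realization of all the random links of a KSWN* on `n` nodes:
for each node its K-neighbour and its two AL-neighbours. -/
structure Config (n : ℕ) where
  K : ZMod n → ZMod n
  AL : ZMod n → Fin 2 → ZMod n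

/-- Probability weight of a configuration: all links are mutually independent. -/
def configProb (n : ℕ) (c : Config n) : ℝ :=
  (∏' u : ZMod n, kProb n u (c.K u)) *
    ∏' u : ZMod n, (alProb n u (c.AL u 0) * alProb n u (c.AL u 1))

/-- Probability of an event over the random construction of the KSWN*. -/
def Pr (n : ℕ) (E : Config n → Prop) : ℝ :=
  ∑' c : Config n, if E c then configProb n c else 0

/-- The `i`-th level `T_i` of the AL-neighbourhood of `x`. -/
def levelT (n : ℕ) (c : Config n) (x : ZMod n) : ℕ → Finset (ZMod n)
  | 0 => {x}
  | i + 1 => (levelT n c x i).biUnion fun u => {c.AL u 0, c.AL u 1}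

/-- The AL-awareness `A_x(k) = H_k = ∪_{j ≤ k} T_j`. -/
def aware (n : ℕ) (c : Config n) (x : ZMod n) (k : ℕ) : Finset (ZMod n) :=
  (Finset.range (k + 1)).biUnion (levelT n c x)

/-- `⌈log₂ log₂ n⌉`, the number of awareness levels used by the algorithms. -/
def kstar (n : ℕ) : ℕ := ⌈Real.logb 2 (Real.logb 2 n)⌉₊

/-- The distance threshold `(log₂ n)² · log₂ log₂ n`. -/
def thresh (n : ℕ) : ℝ := (Real.logb 2 n) ^ 2 * Real.logb 2 (Real.logb 2 n)

/-- Immediate neighbours of `x`: its R-neighbour, K-neighbour and two AL-neighbours. -/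
def neighbors (n : ℕ) (c : Config n) (x : ZMod n) : List (ZMod n) :=
  [x + 1, c.K x, c.AL x 0, c.AL x 1]

/-- Kleinberg greedy step: forward to the immediate neighbour closest to the target `t`. -/
def greedyNext (n : ℕ) (c : Config n) (t x : ZMod n) : ZMod n :=
  ((neighbors n c x).argmin fun y => ringDist n y t).getD x

/-- Position after `k` steps of Kleinberg's greedy routing towards `t`, started at `s`. -/
def greedyTraj (n : ℕ) (c : Config n) (t s : ZMod n) (k : ℕ) : ZMod n :=
  (greedyNext n c t)^[k] s

/-- `v` is an AL-neighbour of `u`. -/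
def alStep (n : ℕ) (c : Config n) (u v : ZMod n) : Prop := c.AL u 0 = v ∨ c.AL u 1 = v

/-- `p` is a path of AL-links from `y` to `z` all of whose nodes lie in `S`. -/
def isPath (n : ℕ) (c : Config n) (S : Finset (ZMod n)) (y z : ZMod n)
    (p : List (ZMod n)) : Prop :=
  p.head? = some y ∧ p.getLast? = some z ∧ p.Chain' (alStep n c) ∧ ∀ v ∈ p, v ∈ S

/-- A shortest AL-path from `y` to `z` inside `S` (the empty list if none exists). -/
def shortestPath (n : ℕ) (c : Config n) (S : Finset (ZMod n)) (y z : ZMod n) :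
    List (ZMod n) :=
  if h : ∃ p, isPath n c S y z p ∧ ∀ q, isPath n c S y z q → p.length ≤ q.length
  then h.choose else []

/-- A node `z` in `A_y(⌈log₂ log₂ n⌉)` whose K-neighbour is closest to `t`
(ties broken by a fixed rule). -/
def chooseZ (n : ℕ) (c : Config n) (t y : ZMod n) : ZMod n :=
  (((aware n c y (kstar n)).toList.argmin fun z => ringDist n (c.K z) t).getD y)

/-- One step of Algorithm 1 (non-oblivious routing); the state is the pair
(current node, header stack). -/
def step1 (n : ℕ) (c : Config n) (t : ZMod n) :
    ZMod n × List (ZMod n) → ZMod n × List (ZMod n) := fun st =>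
  if (ringDist n st.1 t : ℝ) ≥ thresh n then
    match st.2 with
    | [] =>
      let y := c.K st.1
      let z := chooseZ n c t y
      (y, (shortestPath n c (aware n c y (kstar n)) y z).tail)
    | v :: rest => (v, rest)
  else (greedyNext n c t st.1, [])

/-- Position after `k` hops of Algorithm 1 towards `t`, started at `s` with empty stack. -/
def traj1 (n : ℕ) (c : Config n) (t s : ZMod n) (k : ℕ) : ZMod n :=
  ((step1 n c t)^[k] (s, [])).1

/-- One step of Algorithm 2 (oblivious routing) with parameter `cp`. -/
def step2 (n : ℕ) (cp : ℝ) (c : Config n) (t x : ZMod n) : ZMod n :=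
  if (ringDist n x t : ℝ) ≥ cp * thresh n then
    let S := aware n c x (kstar n)
    let cands := S.filter fun z => (ringDist n (c.K z) t : ℝ) ≤ (ringDist n x t : ℝ) / 2
    match cands.toList.argmin fun z => (shortestPath n c S x z).length with
    | none => greedyNext n c t x
    | some z =>
      if z = x then c.K x
      else
        match shortestPath n c S x z with
        | _ :: v :: _ => v
        | _ => greedyNext n c t x
  else greedyNext n c t x

/-- Position after `k` hops of Algorithm 2 (parameter `cp`) towards `t`, started at `s`. -/
def traj2 (n : ℕ) (cp : ℝ) (c : Config n) (t s : ZMod n) (k : ℕ) : ZMod n :=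
  (step2 n cp c t)^[k] s

/-- The first time `k` at which `P k` holds (`⊤` if it never does). -/
def hitTime (P : ℕ → Prop) : ℕ∞ := sInf {k : ℕ∞ | ∃ m : ℕ, P m ∧ k = m}

/-- Expected number of hops until a trajectory first reaches the goal set,
over the random construction of the network. -/
def expHit (n : ℕ) (traj : Config n → ℕ → ZMod n) (Goal : ZMod n → Prop) : ℝ≥0∞ :=
  ∑' c : Config n,
    ENNReal.ofReal (configProb n c) * ((hitTime fun m => Goal (traj c m)) : ℝ≥0∞)

/-- Direction (±1) of the shorter arc from `x` to `t`. -/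
def arcDir (n : ℕ) (x t : ZMod n) : ZMod n := if (t - x).val ≤ (x - t).val then 1 else -1

/-- The point at arc-length `i` from `x` along the shorter arc towards `t`. -/
def arcPoint (n : ℕ) (x t : ZMod n) (i : ℕ) : ZMod n := x + (i : ZMod n) * arcDir n x t

end

section RingDistance

variable {n : ℕ}

theorem two_mul_ringDist_le [NeZero n] (u v : ZMod n) : 2 * ringDist n u v ≤ n := by
  have h : (v - u).val + (u - v).val ≤ n := by
    rw [← neg_sub v u, ZMod.neg_val]
    have := ZMod.val_lt (v - u)
    split_ifs with h
    · simp [h]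
    · omega
  unfold ringDist
  omega

theorem ringDist_comm (u v : ZMod n) : ringDist n u v = ringDist n v u :=
  min_comm _ _

theorem le_ringDist_of_sub_eq [NeZero n] {u v : ZMod n} {d : ℕ} {m : ℝ} (hm : 0 < m)
    (hd : v - u = d) (h₁ : m ≤ d) (h₂ : m ≤ n - d) : m ≤ ringDist n u v := by
  have hdn : d < n := by
    have : (d : ℝ) < n := by linarith
    exact_mod_cast this
  have hd0 : 0 < d := by
    have : (0 : ℝ) < d := by linarith
    exact_mod_cast this
  have hv : (v - u).val = d := by rw [hd, ZMod.val_natCast_of_lt hdn]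
  have hne : v - u ≠ 0 := by
    intro h
    rw [h, ZMod.val_zero] at hv
    omega
  have hv' : (u - v).val = n - d := by
    rw [← neg_sub v u, ZMod.neg_val, if_neg hne, hv]
  rw [ringDist, hv, hv', Nat.cast_min, Nat.cast_sub hdn.le]
  exact le_min h₁ h₂

end RingDistance

section LinkProbabilities

variable {n : ℕ}

theorem kProb_eq (u v : ZMod n) :
    kProb n u v = (Zconst n u)⁻¹ * (ringDist n u v : ℝ)⁻¹ := by
  unfold kProb
  split_ifs with h
  · simp [h, ringDist]
  · rw [mul_inv]

theorem Zconst_eq_sum [NeZero n] (u : ZMod n) :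
    Zconst n u = ∑ z : ZMod n, (ringDist n u z : ℝ)⁻¹ := by
  rw [Zconst, tsum_fintype]
  refine Finset.sum_congr rfl fun z _ => ?_
  split_ifs with h
  · simp [h, ringDist]
  · rfl

theorem Zconst_nonneg [NeZero n] (u : ZMod n) : 0 ≤ Zconst n u := by
  rw [Zconst_eq_sum]
  positivity

theorem kProb_nonneg [NeZero n] (u v : ZMod n) : 0 ≤ kProb n u v := by
  rw [kProb_eq]
  have := Zconst_nonneg u
  positivity

theorem sum_kProb_le_one [NeZero n] (u : ZMod n) : ∑ v, kProb n u v ≤ 1 := by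
  simp_rw [kProb_eq]
  rw [← Finset.mul_sum, ← Zconst_eq_sum]
  exact inv_mul_le_one

theorem alProb_nonneg (u v : ZMod n) : 0 ≤ alProb n u v := by
  unfold alProb
  split_ifs <;> positivity

theorem sum_alProb_le_one [NeZero n] (u : ZMod n) : ∑ v, alProb n u v ≤ 1 := by
  let s : Finset (ZMod n) := (Finset.Icc 1 (alCount n)).image fun i : ℕ => u + (i : ZMod n)
  have hs : ∀ v, alProb n u v = if v ∈ s then ((alCount n : ℝ))⁻¹ else 0 := fun v => by
    unfold alProb
    have hmem : v ∈ s ↔ ∃ i ∈ Finset.Icc 1 (alCount n), u + (i : ZMod n) = v := Finset.mem_image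
    by_cases h : v ∈ s
    · rw [if_pos h, if_pos (hmem.1 h)]
    · rw [if_neg h, if_neg (mt hmem.2 h)]
  have hcard : (s.card : ℝ) ≤ alCount n := by
    have : s.card ≤ (Finset.Icc 1 (alCount n)).card := Finset.card_image_le
    rw [Nat.card_Icc, Nat.add_sub_cancel] at this
    exact_mod_cast this
  simp_rw [hs]
  rw [Finset.sum_ite_mem, Finset.univ_inter, Finset.sum_const, nsmul_eq_mul]
  calc (s.card : ℝ) * (alCount n : ℝ)⁻¹ ≤ alCount n * (alCount n : ℝ)⁻¹ := by gcongr
    _ ≤ 1 := mul_inv_le_one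

theorem sum_zmod_val_eq_sum_range [NeZero n] (f : ℕ → ℝ) :
    ∑ z : ZMod n, f z.val = ∑ k ∈ Finset.range n, f k := by
  obtain ⟨m, rfl⟩ : ∃ m, n = m + 1 := Nat.exists_eq_succ_of_ne_zero (NeZero.ne n)
  exact Fin.sum_univ_eq_sum_range f (m + 1)

theorem log_le_Zconst [NeZero n] (u : ZMod n) : Real.log n ≤ Zconst n u := by
  obtain ⟨m, hm⟩ : ∃ m, n = m + 1 := Nat.exists_eq_succ_of_ne_zero (NeZero.ne n)
  have hharm : Real.log n ≤ ∑ k ∈ Finset.range n, (k : ℝ)⁻¹ := by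
    have h := log_add_one_le_harmonic m
    rw [hm, Finset.sum_range_succ']
    simpa [harmonic] using h
  rw [← sum_zmod_val_eq_sum_range (fun k => (k : ℝ)⁻¹),
    ← Equiv.sum_comp (Equiv.subRight u)] at hharm
  rw [Zconst_eq_sum]
  refine hharm.trans (Finset.sum_le_sum fun z _ => ?_)
  simp only [Equiv.subRight_apply]
  rcases eq_or_ne z u with rfl | hzu
  · simp [ringDist]
  · have h₁ : 0 < (z - u).val := ZMod.val_pos.2 (sub_ne_zero.2 hzu)
    have h₂ : 0 < (u - z).val := ZMod.val_pos.2 (sub_ne_zero.2 hzu.symm)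
    apply inv_anti₀
    · exact_mod_cast lt_min h₁ h₂
    · exact_mod_cast min_le_left _ _

end LinkProbabilities

section UnionBound

variable {n : ℕ}

theorem sum_pi_prod_le_one {ι κ : Type*} [Fintype ι] [DecidableEq ι] [Fintype κ]
    {p : ι → κ → ℝ} (hp : ∀ i j, 0 ≤ p i j) (hs : ∀ i, ∑ j, p i j ≤ 1) :
    ∑ f : ι → κ, ∏ i, p i (f i) ≤ 1 := by
  rw [← Fintype.piFinset_univ, ← Finset.prod_univ_sum]
  exact Finset.prod_le_one (fun i _ => Finset.sum_nonneg fun j _ => hp i j) fun i _ => hs i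

theorem sum_pi_prod_ite_mem_le {ι κ : Type*} [Fintype ι] [DecidableEq ι] [Fintype κ]
    {p : ι → κ → ℝ} (hp : ∀ i j, 0 ≤ p i j) (hs : ∀ i, ∑ j, p i j ≤ 1) (a : ι) (S : Finset κ) :
    (∑ f : ι → κ, if f a ∈ S then ∏ i, p i (f i) else 0) ≤ ∑ j ∈ S, p a j := by
  have hpi : (Finset.univ.filter fun f : ι → κ => f a ∈ S) =
      Fintype.piFinset fun i => if i = a then S else Finset.univ := by
    ext f
    simp only [Finset.mem_filter, Finset.mem_univ, true_and, Fintype.mem_piFinset]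
    constructor
    · intro h i
      split_ifs with hi
      · rwa [hi]
      · exact Finset.mem_univ _
    · intro h
      simpa using h a
  rw [← Finset.sum_filter, hpi, ← Finset.prod_univ_sum,
    ← Finset.mul_prod_erase _ _ (Finset.mem_univ a), if_pos rfl]
  refine mul_le_of_le_one_right (Finset.sum_nonneg fun j _ => hp a j) ?_
  refine Finset.prod_le_one (fun i _ => Finset.sum_nonneg fun j _ => hp i j) fun i hi => ?_
  rw [if_neg (Finset.ne_of_mem_erase hi)]
  exact hs i

theorem sum_pi_prod_ite_le {ι κ : Type*} [Fintype ι] [DecidableEq ι] [Fintype κ]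
    {p : ι → κ → ℝ} (hp : ∀ i j, 0 ≤ p i j) (hs : ∀ i, ∑ j, p i j ≤ 1) {A : Finset ι}
    {S : Finset κ} {P : (ι → κ) → Prop} {_ : DecidablePred P} (hP : ∀ f, P f → ∃ a ∈ A, f a ∈ S) :
    (∑ f : ι → κ, if P f then ∏ i, p i (f i) else 0) ≤ ∑ a ∈ A, ∑ j ∈ S, p a j := by
  refine le_trans ?_ (Finset.sum_le_sum fun a _ => sum_pi_prod_ite_mem_le hp hs a S)
  rw [Finset.sum_comm]
  refine Finset.sum_le_sum fun f _ => ?_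
  have hnn : 0 ≤ ∏ i, p i (f i) := Finset.prod_nonneg fun i _ => hp i _
  have hterm : ∀ a ∈ A, 0 ≤ if f a ∈ S then ∏ i, p i (f i) else 0 := fun a _ => by
    split_ifs
    · exact hnn
    · exact le_rfl
  split_ifs with h
  · obtain ⟨a, ha, haS⟩ := hP f h
    refine le_trans ?_ (Finset.single_le_sum hterm ha)
    rw [if_pos haS]
  · exact Finset.sum_nonneg hterm

theorem sum_prod_alProb_le_one [NeZero n] :
    ∑ g : ZMod n → Fin 2 → ZMod n, ∏ u, (alProb n u (g u 0) * alProb n u (g u 1)) ≤ 1 := by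
  refine sum_pi_prod_le_one (p := fun u (h : Fin 2 → ZMod n) => alProb n u (h 0) * alProb n u (h 1))
    (fun u h => mul_nonneg (alProb_nonneg _ _) (alProb_nonneg _ _)) fun u => ?_
  have := sum_pi_prod_le_one (ι := Fin 2) (p := fun _ => alProb n u)
    (fun _ => alProb_nonneg u) fun _ => sum_alProb_le_one u
  simpa only [Fin.prod_univ_two] using this

/-- A configuration is a choice of the K-links together with a choice of the AL-links. -/
def configEquiv (n : ℕ) :
    (ZMod n → Fin 2 → ZMod n) × (ZMod n → ZMod n) ≃ Config n where
  toFun p := ⟨p.2, p.1⟩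
  invFun c := (c.AL, c.K)
  left_inv _ := rfl
  right_inv _ := rfl

theorem Pr_le_of_forall_AL [NeZero n] {E : Config n → Prop} {B : ℝ} (hB : 0 ≤ B)
    (h : ∀ g : ZMod n → Fin 2 → ZMod n, (∀ u j, alProb n u (g u j) ≠ 0) →
      (∑ f : ZMod n → ZMod n, if E ⟨f, g⟩ then ∏ u, kProb n u (f u) else 0) ≤ B) :
    Pr n E ≤ B := by
  have hPr : Pr n E = ∑ g : ZMod n → Fin 2 → ZMod n,
      (∏ u, (alProb n u (g u 0) * alProb n u (g u 1))) *
        ∑ f : ZMod n → ZMod n, if E ⟨f, g⟩ then ∏ u, kProb n u (f u) else 0 := by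
    rw [Pr, ← (configEquiv n).tsum_eq, tsum_fintype, Fintype.sum_prod_type]
    refine Finset.sum_congr rfl fun g _ => ?_
    rw [Finset.mul_sum]
    refine Finset.sum_congr rfl fun f _ => ?_
    simp only [configEquiv, Equiv.coe_fn_mk, configProb, tprod_fintype, mul_ite, mul_zero]
    rw [mul_comm]
  rw [hPr]
  calc _ ≤ ∑ g : ZMod n → Fin 2 → ZMod n,
        (∏ u, (alProb n u (g u 0) * alProb n u (g u 1))) * B := by
        refine Finset.sum_le_sum fun g _ => ?_
        by_cases hg : ∏ u, (alProb n u (g u 0) * alProb n u (g u 1)) = 0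
        · simp [hg]
        · refine mul_le_mul_of_nonneg_left (h g ?_) (Finset.prod_nonneg fun u _ =>
            mul_nonneg (alProb_nonneg _ _) (alProb_nonneg _ _))
          intro u j
          have hu := mul_ne_zero_iff.1 (Finset.prod_ne_zero_iff.1 hg u (Finset.mem_univ u))
          fin_cases j
          · exact hu.1
          · exact hu.2
    _ ≤ B := by
        rw [← Finset.sum_mul]
        exact mul_le_of_le_one_left hB sum_prod_alProb_le_one

theorem Pr_le_one [NeZero n] (E : Config n → Prop) : Pr n E ≤ 1 := by
  refine Pr_le_of_forall_AL zero_le_one fun g _ => ?_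
  refine le_trans (Finset.sum_le_sum fun f _ => ?_)
    (sum_pi_prod_le_one (p := kProb n) kProb_nonneg sum_kProb_le_one)
  split_ifs
  · exact le_rfl
  · exact Finset.prod_nonneg fun u _ => kProb_nonneg _ _

end UnionBound

section Awareness

variable {n : ℕ}

theorem levelT_congr {c c' : Config n} (h : c.AL = c'.AL) (x : ZMod n) (i : ℕ) :
    levelT n c x i = levelT n c' x i := by
  induction i with
  | zero => rfl
  | succ i ih => simp only [levelT, ih, h]

theorem aware_congr {c c' : Config n} (h : c.AL = c'.AL) (x : ZMod n) (k : ℕ) :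
    aware n c x k = aware n c' x k := by
  unfold aware
  rw [funext (levelT_congr h x)]

theorem card_levelT_le (c : Config n) (x : ZMod n) (i : ℕ) : (levelT n c x i).card ≤ 2 ^ i := by
  induction i with
  | zero => simp [levelT]
  | succ i ih =>
    rw [levelT, pow_succ]
    exact (Finset.card_biUnion_le_card_mul _ _ 2 fun u _ => Finset.card_le_two).trans
      (Nat.mul_le_mul_right 2 ih)

theorem card_aware_le (c : Config n) (x : ZMod n) (k : ℕ) :
    (aware n c x k).card ≤ 2 ^ (k + 1) := by
  calc (aware n c x k).card ≤ ∑ i ∈ Finset.range (k + 1), (levelT n c x i).card :=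
        Finset.card_biUnion_le
    _ ≤ ∑ i ∈ Finset.range (k + 1), 2 ^ i := Finset.sum_le_sum fun i _ => card_levelT_le c x i
    _ ≤ 2 ^ (k + 1) := by
        rw [Nat.geomSum_eq le_rfl]
        simp

theorem exists_eq_add_of_mem_levelT {c : Config n} (hc : ∀ u j, alProb n u (c.AL u j) ≠ 0)
    {x : ZMod n} {i : ℕ} {z : ZMod n} (hz : z ∈ levelT n c x i) :
    ∃ j ≤ i * alCount n, z = x + (j : ZMod n) := by
  induction i generalizing z with
  | zero => exact ⟨0, Nat.zero_le _, by simpa [levelT] using hz⟩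
  | succ i ih =>
    simp only [levelT, Finset.mem_biUnion, Finset.mem_insert, Finset.mem_singleton] at hz
    obtain ⟨u, hu, hz⟩ := hz
    obtain ⟨j, hj, rfl⟩ := ih hu
    have hstep : ∃ l, z = c.AL (x + (j : ZMod n)) l := by
      rcases hz with hz | hz
      exacts [⟨0, hz⟩, ⟨1, hz⟩]
    obtain ⟨l, rfl⟩ := hstep
    have hl := hc (x + (j : ZMod n)) l
    obtain ⟨a, ha, hal⟩ : ∃ a ∈ Finset.Icc 1 (alCount n),
        x + (j : ZMod n) + (a : ZMod n) = c.AL (x + (j : ZMod n)) l := by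
      by_contra h
      exact hl (if_neg h)
    refine ⟨j + a, ?_, ?_⟩
    · rw [Nat.succ_mul]
      exact Nat.add_le_add hj (Finset.mem_Icc.1 ha).2
    · rw [← hal, Nat.cast_add, add_assoc]

theorem exists_eq_add_of_mem_aware {c : Config n} (hc : ∀ u j, alProb n u (c.AL u j) ≠ 0)
    {x : ZMod n} {k : ℕ} {z : ZMod n} (hz : z ∈ aware n c x k) :
    ∃ j ≤ k * alCount n, z = x + (j : ZMod n) := by
  obtain ⟨i, hi, hz⟩ := Finset.mem_biUnion.1 hz
  obtain ⟨j, hj, rfl⟩ := exists_eq_add_of_mem_levelT hc hz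
  exact ⟨j, hj.trans (Nat.mul_le_mul_right _ (Finset.mem_range_succ_iff.1 hi)), rfl⟩

/-- A point obtained from `x` by a short forward move stays far from the points near the
midpoint of the segment from `x` to `t`. -/
theorem quarter_le_ringDist_arcPoint [NeZero n] {x t : ZMod n} {i j : ℕ}
    (hD : 0 < ringDist n x t) (hi : ringDist n x t / 2 ≤ i)
    (hij : 4 * (i + j) ≤ 3 * ringDist n x t) (hj : 8 * j + 4 ≤ ringDist n x t) :
    (ringDist n x t : ℝ) / 4 ≤ ringDist n (x + (j : ZMod n)) (arcPoint n x t i) := by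
  have hn := two_mul_ringDist_le x t
  set D := ringDist n x t
  have hD' : (0 : ℝ) < D / 4 := by positivity
  have hnR : 2 * (D : ℝ) ≤ n := by exact_mod_cast hn
  have hiR : (D : ℝ) ≤ 2 * i + 1 := by
    have : D ≤ 2 * i + 1 := by omega
    exact_mod_cast this
  have hijR : 4 * ((i : ℝ) + j) ≤ 3 * D := by exact_mod_cast hij
  have hjR : 8 * (j : ℝ) + 4 ≤ D := by exact_mod_cast hj
  have hj0 : (0 : ℝ) ≤ j := j.cast_nonneg
  have hji : j ≤ i := by omega
  unfold arcPoint arcDir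
  split_ifs
  · refine le_ringDist_of_sub_eq (d := i - j) hD' ?_ ?_ ?_
    · rw [Nat.cast_sub hji]
      ring
    · rw [Nat.cast_sub hji]
      linarith
    · rw [Nat.cast_sub hji]
      linarith
  · rw [ringDist_comm]
    refine le_ringDist_of_sub_eq (d := i + j) hD' ?_ ?_ ?_
    · push_cast
      ring
    · push_cast
      linarith
    · push_cast
      linarith

end Awareness

section Asymptotics

variable {n : ℕ}

theorem four_le_logb (hn : 16 ≤ n) : 4 ≤ Real.logb 2 n := by
  rw [Real.le_logb_iff_rpow_le (by norm_num) (by positivity)]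
  norm_num
  exact hn

theorem two_le_logb_logb (hn : 16 ≤ n) : 2 ≤ Real.logb 2 (Real.logb 2 n) := by
  have h := four_le_logb hn
  rw [Real.le_logb_iff_rpow_le (by norm_num) (by linarith)]
  norm_num
  exact h

theorem thirtytwo_le_thresh (hn : 16 ≤ n) : 32 ≤ thresh n := by
  have h₁ := four_le_logb hn
  have h₂ := two_le_logb_logb hn
  have h₃ : 16 ≤ Real.logb 2 n ^ 2 := by nlinarith
  unfold thresh
  nlinarith

theorem two_pow_kstar_succ_le (hn : 16 ≤ n) :
    (2 : ℝ) ^ (kstar n + 1) ≤ 4 * Real.logb 2 n := by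
  have h₁ := four_le_logb hn
  have h₂ := two_le_logb_logb hn
  have h : (kstar n : ℝ) ≤ Real.logb 2 (Real.logb 2 n) + 1 :=
    (Nat.ceil_lt_add_one (by linarith)).le
  have hpow : (2 : ℝ) ^ (kstar n) ≤ 2 * Real.logb 2 n := by
    rw [← Real.rpow_natCast]
    refine (Real.rpow_le_rpow_of_exponent_le one_le_two h).trans ?_
    rw [Real.rpow_add two_pos, Real.rpow_logb two_pos (by norm_num) (by linarith), Real.rpow_one,
      mul_comm]
  rw [pow_succ]
  linarith

theorem kstar_mul_alCount_le (hn : 16 ≤ n) :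
    ((kstar n * alCount n : ℕ) : ℝ) ≤ 4 * thresh n := by
  have h₁ := four_le_logb hn
  have h₂ := two_le_logb_logb hn
  have hk : (kstar n : ℝ) ≤ 2 * Real.logb 2 (Real.logb 2 n) := by
    have : (kstar n : ℝ) ≤ _ := (Nat.ceil_lt_add_one (by linarith)).le
    linarith
  have ha : (alCount n : ℝ) ≤ 2 * Real.logb 2 n ^ 2 := by
    have : (alCount n : ℝ) ≤ _ := (Nat.ceil_lt_add_one (sq_nonneg _)).le
    nlinarith
  rw [Nat.cast_mul]
  calc (kstar n : ℝ) * alCount n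
      ≤ (2 * Real.logb 2 (Real.logb 2 n)) * (2 * Real.logb 2 n ^ 2) := by gcongr
    _ = 4 * thresh n := by unfold thresh; ring

theorem half_logb_le_Zconst [NeZero n] (u : ZMod n) : Real.logb 2 n / 2 ≤ Zconst n u := by
  refine le_trans ?_ (log_le_Zconst u)
  have h2 : (1 / 2 : ℝ) ≤ Real.log 2 := by linarith [Real.log_two_gt_d9]
  have hlog : 0 ≤ Real.log n := Real.log_natCast_nonneg n
  rw [Real.logb, div_div, div_le_iff₀ (by positivity)]
  nlinarith

/-- The segment of nodes between the points `r` and `r'`. -/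
noncomputable def midSegment (n : ℕ) (x t : ZMod n) : Finset (ZMod n) :=
  (Finset.Icc (ringDist n x t / 2) (ringDist n x t / 2 + ⌈thresh n⌉₊)).image (arcPoint n x t)

theorem card_midSegment_le (hn : 16 ≤ n) (x t : ZMod n) :
    ((midSegment n x t).card : ℝ) ≤ 2 * thresh n := by
  have hT := thirtytwo_le_thresh hn
  have h : (midSegment n x t).card ≤ ⌈thresh n⌉₊ + 1 := by
    refine Finset.card_image_le.trans ?_
    rw [Nat.card_Icc]
    omega
  have hR : ((midSegment n x t).card : ℝ) ≤ ⌈thresh n⌉₊ + 1 := by exact_mod_cast h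
  have := (Nat.ceil_lt_add_one (show 0 ≤ thresh n by linarith)).le
  linarith

theorem kProb_midSegment_le (hn : 16 ≤ n) [NeZero n] {cp : ℝ} (hcp : 64 ≤ cp) {x t z v : ZMod n}
    (hxt : cp * thresh n ≤ ringDist n x t) {j : ℕ} (hj : j ≤ kstar n * alCount n)
    (hz : z = x + (j : ZMod n)) (hv : v ∈ midSegment n x t) :
    kProb n z v ≤ 8 / (cp * Real.logb 2 n * thresh n) := by
  have hL := four_le_logb hn
  have hT := thirtytwo_le_thresh hn
  have hjT : (j : ℝ) ≤ 4 * thresh n :=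
    le_trans (by exact_mod_cast hj) (kstar_mul_alCount_le hn)
  obtain ⟨i, hi, rfl⟩ := Finset.mem_image.1 hv
  rw [Finset.mem_Icc] at hi
  have hDT : 64 * thresh n ≤ ringDist n x t := le_trans (by gcongr) hxt
  have hceil := (Nat.ceil_lt_add_one (show 0 ≤ thresh n by linarith)).le
  have hiR : (i : ℝ) ≤ (ringDist n x t : ℝ) / 2 + thresh n + 1 := by
    have h₁ : (i : ℝ) ≤ (ringDist n x t / 2 : ℕ) + ⌈thresh n⌉₊ := by exact_mod_cast hi.2
    have h₂ : ((ringDist n x t / 2 : ℕ) : ℝ) ≤ (ringDist n x t : ℝ) / 2 := by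
      exact_mod_cast Nat.cast_div_le (α := ℝ) (m := ringDist n x t) (n := 2)
    linarith
  have hdist : (ringDist n x t : ℝ) / 4 ≤ ringDist n z (arcPoint n x t i) := by
    rw [hz]
    refine quarter_le_ringDist_arcPoint ?_ hi.1 ?_ ?_
    · have : (0 : ℝ) < ringDist n x t := by linarith
      exact_mod_cast this
    · have : 4 * ((i : ℝ) + j) ≤ 3 * ringDist n x t := by linarith
      exact_mod_cast this
    · have : 8 * (j : ℝ) + 4 ≤ ringDist n x t := by linarith
      exact_mod_cast this
  have hZ := half_logb_le_Zconst z
  have hd : cp * thresh n / 4 ≤ ringDist n z (arcPoint n x t i) := by linarith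
  have hpos : 0 < cp * thresh n := by positivity
  rw [kProb_eq]
  calc (Zconst n z)⁻¹ * (ringDist n z (arcPoint n x t i) : ℝ)⁻¹
      ≤ (Real.logb 2 n / 2)⁻¹ * (cp * thresh n / 4)⁻¹ := by gcongr
    _ = 8 / (cp * Real.logb 2 n * thresh n) := by
        field_simp
        norm_num

end Asymptotics

/-- There is a constant `κ > 0` such that for every constant `c ≥ 1` and all
sufficiently large `n`: if `Dist(x,t) ≥ c·(log₂ n)²·log₂ log₂ n`, `r` is the midpoint of the
segment from `x` to `t`, and `r'` is the node between `r` and `t` at distance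
`⌈(log₂ n)²·log₂ log₂ n⌉` from `r`, then the probability that some node of
`A_x(⌈log₂ log₂ n⌉)` has its K-neighbour in the segment of nodes between `r` and `r'`
is at most `κ/c`. -/
theorem awareness_kLink_in_rr'_unlikely :
    ∃ κ : ℝ, 0 < κ ∧ ∀ cp : ℝ, 1 ≤ cp → ∃ N : ℕ, ∀ n : ℕ, N ≤ n → ∀ x t : ZMod n,
      cp * thresh n ≤ (ringDist n x t : ℝ) →
      Pr n (fun c => ∃ z ∈ aware n c x (kstar n),
          ∃ i ∈ Finset.Icc (ringDist n x t / 2) (ringDist n x t / 2 + ⌈thresh n⌉₊),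
            c.K z = arcPoint n x t i) ≤ κ / cp := by
  refine ⟨64, by norm_num, fun cp hcp => ⟨16, fun n hn x t hxt => ?_⟩⟩
  have : NeZero n := ⟨by omega⟩
  rcases le_total cp 64 with h64 | h64
  · refine (Pr_le_one _).trans ?_
    rwa [le_div_iff₀ (by linarith), one_mul]
  have hL := four_le_logb hn
  have hT := thirtytwo_le_thresh hn
  refine Pr_le_of_forall_AL (by positivity) fun g hg => ?_
  have hevent : ∀ f : ZMod n → ZMod n, (∃ z ∈ aware n ⟨f, g⟩ x (kstar n),
      ∃ i ∈ Finset.Icc (ringDist n x t / 2) (ringDist n x t / 2 + ⌈thresh n⌉₊),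
        f z = arcPoint n x t i) →
      ∃ z ∈ aware n ⟨id, g⟩ x (kstar n), f z ∈ midSegment n x t := by
    rintro f ⟨z, hz, i, hi, hfz⟩
    rw [aware_congr (c := ⟨f, g⟩) (c' := ⟨id, g⟩) rfl] at hz
    exact ⟨z, hz, Finset.mem_image.2 ⟨i, hi, hfz.symm⟩⟩
  refine (sum_pi_prod_ite_le kProb_nonneg sum_kProb_le_one hevent).trans ?_
  set A := aware n ⟨id, g⟩ x (kstar n)
  have hcardA : (A.card : ℝ) ≤ 4 * Real.logb 2 n :=
    le_trans (by exact_mod_cast card_aware_le _ _ _) (two_pow_kstar_succ_le hn)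
  calc ∑ z ∈ A, ∑ v ∈ midSegment n x t, kProb n z v
      ≤ ∑ _z ∈ A, ∑ _v ∈ midSegment n x t, 8 / (cp * Real.logb 2 n * thresh n) := by
        refine Finset.sum_le_sum fun z hz => Finset.sum_le_sum fun v hv => ?_
        obtain ⟨j, hj, hzj⟩ := exists_eq_add_of_mem_aware hg hz
        exact kProb_midSegment_le hn h64 hxt hj hzj hv
    _ = A.card * ((midSegment n x t).card * (8 / (cp * Real.logb 2 n * thresh n))) := by
        simp only [Finset.sum_const, nsmul_eq_mul]
    _ ≤ (4 * Real.logb 2 n) * ((2 * thresh n) * (8 / (cp * Real.logb 2 n * thresh n))) := by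
        gcongr
        exact card_midSegment_le hn x t
    _ = 64 / cp := by
        field_simp
        norm_num
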